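/- arXiv:2202.10105 — 2 statements merged into one kernel-verified Lean document; each statement's English description precedes it below -/
import Mathlib

section
/- Let a > 0. There exist constants C > 0 and t₀ > 0 such that for all t ≥ t₀: |∫₀ᵃ e^{−ixt}/x^{1/2} dx − (π/(2t))^{1/2}(1 − i)| ≤ C/t, i.e., ∫₀ᵃ e^{−ixt} x^{−1/2} dx = √(π/(2t))·(1 − i) + O(1/t) as t → ∞. -/
open MeasureTheory Real

noncomputable section

open Set Filter Topology in
lemma gauss_tail (A : ℝ) (hA : 0 < A) (b : ℂ) (hb : 0 < b.re) :
    ‖2 * (∫ u in (0:ℝ)..A, Complex.exp (-b * (u:ℂ)^2)) - ((π : ℂ) / b) ^ (1/2 : ℂ)‖ ≤ 2 / A / ‖b‖ := by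
  have hb0 : b ≠ 0 := by rintro rfl; simp at hb
  have hint := integrable_cexp_neg_mul_sq hb
  have h1 := integral_gaussian_complex_Ioi hb
  have h2 : (∫ u in (0:ℝ)..A, Complex.exp (-b * (u:ℂ)^2)) + ∫ u in Ioi A, Complex.exp (-b * (u:ℂ)^2)
      = ∫ u in Ioi (0:ℝ), Complex.exp (-b * (u:ℂ)^2) :=
    intervalIntegral.integral_interval_add_Ioi hint.integrableOn hint.integrableOn
  have hnorm : ∀ u : ℝ, ‖Complex.exp (-b * (u:ℂ)^2)‖ ≤ 1 := by
    intro u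
    rw [norm_cexp_neg_mul_sq, Real.exp_le_one_iff]
    nlinarith [sq_nonneg u]
  have hbd : ∀ᵐ u : ℝ ∂(volume.restrict (Ioi A)), ‖Complex.exp (-b * (u:ℂ)^2) / (u:ℂ)^2‖ ≤ u ^ (-2 : ℝ) := by
    filter_upwards [ae_restrict_mem measurableSet_Ioi] with u hu
    have hu0 : 0 < u := hA.trans hu
    rw [norm_div, norm_pow, Complex.norm_real, Real.norm_eq_abs, sq_abs, Real.rpow_neg hu0.le,
      div_eq_mul_inv]
    norm_num
    exact mul_le_of_le_one_left (by positivity) (by simpa using hnorm u)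
  have hi2 : IntegrableOn (fun u : ℝ => u ^ (-2 : ℝ)) (Ioi A) :=
    integrableOn_Ioi_rpow_of_lt (by norm_num) hA
  have hg : IntegrableOn (fun u : ℝ => Complex.exp (-b * (u:ℂ)^2) / (u:ℂ)^2) (Ioi A) :=
    Integrable.mono' hi2 (Measurable.aestronglyMeasurable (by fun_prop)) hbd
  have hgn : ‖∫ u in Ioi A, Complex.exp (-b * (u:ℂ)^2) / (u:ℂ)^2‖ ≤ 1 / A := by
    refine (norm_integral_le_of_norm_le hi2 hbd).trans ?_
    rw [integral_Ioi_rpow_of_lt (by norm_num) hA]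
    norm_num [Real.rpow_neg hA.le]
  have hF : ∫ u in Ioi A, ((-2 * b) * Complex.exp (-b * (u:ℂ)^2) - Complex.exp (-b * (u:ℂ)^2) / (u:ℂ)^2)
      = 0 - Complex.exp (-b * (A:ℂ)^2) / A := by
    refine integral_Ioi_of_hasDerivAt_of_tendsto' (f := fun u : ℝ => Complex.exp (-b * (u:ℂ)^2) / u) ?_ ?_ ?_
    · intro u hu
      have hu0 : (u:ℂ) ≠ 0 := by exact_mod_cast (hA.trans_le hu).ne'
      have : HasDerivAt (fun z : ℂ => Complex.exp (-b * z^2) / z)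
        ((-2 * b) * Complex.exp (-b * (u:ℂ)^2) - Complex.exp (-b * (u:ℂ)^2) / (u:ℂ)^2) (u:ℂ) := by
        have := ((((hasDerivAt_id (u:ℂ)).pow 2).const_mul (-b)).cexp).div (hasDerivAt_id (u:ℂ)) hu0
        refine HasDerivAt.congr_deriv this ?_
        simp
        field_simp
      exact this.comp_ofReal
    · exact (hint.integrableOn.const_mul _).sub hg
    · refine squeeze_zero_norm' (a := fun u : ℝ => u⁻¹) ?_ tendsto_inv_atTop_zero
      filter_upwards [eventually_gt_atTop 0] with u hu
      rw [norm_div, Complex.norm_real, Real.norm_of_nonneg hu.le, div_eq_mul_inv]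
      exact mul_le_of_le_one_left (by positivity) (hnorm u)
  rw [integral_sub (hint.integrableOn.const_mul _) hg, integral_const_mul] at hF
  have key : 2 * (∫ u in (0:ℝ)..A, Complex.exp (-b * (u:ℂ)^2)) - ((π : ℂ) / b) ^ (1/2 : ℂ)
     = (-(Complex.exp (-b * (A:ℂ)^2) / A) + ∫ u in Ioi A, Complex.exp (-b * (u:ℂ)^2) / (u:ℂ)^2) / b := by
    rw [eq_div_iff hb0]
    rw [h1] at h2
    linear_combination 2 * b * h2 + hF
  rw [key, norm_div]
  gcongr
  refine (norm_add_le _ _).trans ?_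
  have : ‖-(Complex.exp (-b * (A:ℂ)^2) / A)‖ ≤ 1 / A := by
    rw [norm_neg, norm_div, Complex.norm_real, Real.norm_of_nonneg hA.le]
    gcongr
    exact hnorm A
  calc _ ≤ 1 / A + 1 / A := add_le_add this hgn
    _ = 2 / A := by ring

open Set Filter Topology in
lemma osc_gauss (A : ℝ) (hA : 0 < A) (t : ℝ) (ht : 0 < t) :
    ‖2 * (∫ u in (0:ℝ)..A, Complex.exp (-(Complex.I * t) * (u:ℂ)^2))
      - (Real.sqrt (π / (2 * t)) : ℂ) * (1 - Complex.I)‖ ≤ 2 / A / t := by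
  have hs : 0 < √(π / (2 * t)) := Real.sqrt_pos.2 (by positivity)
  have hroot : ((π : ℂ) / (Complex.I * t)) ^ (1/2 : ℂ)
      = (Real.sqrt (π / (2 * t)) : ℂ) * (1 - Complex.I) := by
    have h : (π : ℂ) / (Complex.I * t) = ((Real.sqrt (π / (2 * t)) : ℂ) * (1 - Complex.I)) ^ 2 := by
      have : ((Real.sqrt (π / (2 * t)) : ℂ)) ^ 2 = π / (2 * t) := by
        have := Real.sq_sqrt (show 0 ≤ π / (2 * t) by positivity)
        exact_mod_cast this
      rw [mul_pow, this]
      have ht' : (t:ℂ) ≠ 0 := by exact_mod_cast ht.ne'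
      have h4 : (1 - Complex.I)^2 = -2 * Complex.I := by
        linear_combination Complex.I_sq
      rw [h4]
      field_simp
      linear_combination Complex.I_sq
    rw [h, one_div]
    exact Complex.sq_cpow_two_inv (by simpa using hs)
  rw [← hroot]
  let B : ℝ → ℂ := fun e => e + Complex.I * t
  have hB : Continuous B := by fun_prop
  have hB0 : B 0 = Complex.I * t := by simp [B]
  have hne : B 0 ≠ 0 := by rw [hB0]; simp [ht.ne']
  have hI : Continuous (fun e => ∫ u in (0:ℝ)..A, Complex.exp (-(B e) * (u:ℂ)^2)) := by
    apply intervalIntegral.continuous_parametric_intervalIntegral_of_continuous'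
    fun_prop
  have hP : ContinuousAt (fun e => ((π:ℂ) / B e) ^ (1/2 : ℂ)) 0 := by
    refine ContinuousAt.cpow (continuousAt_const.div hB.continuousAt hne) continuousAt_const ?_
    rw [hB0, Complex.mem_slitPlane_iff]
    right
    have : (π : ℂ) / (Complex.I * t) = ((-(π/t) : ℝ) : ℂ) * Complex.I := by
      have ht' : (t:ℂ) ≠ 0 := by exact_mod_cast ht.ne'
      push_cast
      field_simp
      linear_combination Complex.I_sq
    rw [this, Complex.im_ofReal_mul]
    simp [ht.ne', Real.pi_ne_zero]
  have hL : ContinuousAt (fun e => ‖2 * (∫ u in (0:ℝ)..A, Complex.exp (-(B e) * (u:ℂ)^2)) - ((π:ℂ) / B e) ^ (1/2 : ℂ)‖) 0 :=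
    ((continuousAt_const.mul hI.continuousAt).sub hP).norm
  have hR : ContinuousAt (fun e => 2 / A / ‖B e‖) 0 :=
    continuousAt_const.div hB.norm.continuousAt (by simpa using hne)
  have := le_of_tendsto_of_tendsto (b := 𝓝[>] (0:ℝ)) (hL.tendsto.mono_left nhdsWithin_le_nhds) (hR.tendsto.mono_left nhdsWithin_le_nhds)
    (by filter_upwards [self_mem_nhdsWithin] with e he
        exact gauss_tail A hA (B e) (by simpa [B] using he))
  simp only [hB0] at this
  simpa [abs_of_pos ht] using this

lemma osc_subst (a : ℝ) (ha : 0 < a) (t : ℝ) :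
    (∫ x in (0 : ℝ)..a, Complex.exp (-Complex.I * x * t) / (Real.sqrt x : ℂ))
     = 2 * (∫ u in (0:ℝ)..(√a), Complex.exp (-(Complex.I * t) * (u:ℂ)^2)) := by
  have hA := Real.sqrt_pos.2 ha
  have hfun : ∀ u : ℝ, 0 < u → (2 * u : ℝ) • (Complex.exp (-Complex.I * ((u^2 : ℝ):ℂ) * t) / (Real.sqrt (u^2) : ℂ))
     = 2 * Complex.exp (-(Complex.I * t) * (u:ℂ)^2) := by
    intro u hu
    rw [Real.sqrt_sq hu.le, Complex.real_smul]
    have : (u:ℂ) ≠ 0 := by exact_mod_cast hu.ne'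
    push_cast
    rw [show -Complex.I * (u:ℂ)^2 * t = -(Complex.I * t) * (u:ℂ)^2 by ring]
    field_simp
  have himg : (fun u : ℝ => u^2) '' Set.uIcc 0 (√a) ⊆ Set.Icc 0 a := by
    rintro _ ⟨u, hu, rfl⟩
    rw [Set.uIcc_of_le hA.le] at hu
    exact ⟨sq_nonneg u, by rw [← Real.sq_sqrt ha.le]; exact pow_le_pow_left₀ hu.1 hu.2 2⟩
  have h := intervalIntegral.integral_deriv_smul_comp''' (a := 0) (b := √a) (f := fun u : ℝ => u^2)
    (f' := fun u => 2 * u) (g := fun x : ℝ => Complex.exp (-Complex.I * x * t) / (Real.sqrt x : ℂ))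
    (by fun_prop) (fun u _ => by simpa using (hasDerivAt_pow 2 u).hasDerivWithinAt) ?_ ?_ ?_
  · simp only [Function.comp] at h
    rw [zero_pow two_ne_zero, Real.sq_sqrt ha.le] at h
    rw [← h, ← intervalIntegral.integral_const_mul]
    refine intervalIntegral.integral_congr_ae (Filter.Eventually.of_forall fun u hu => ?_)
    rw [Set.uIoc_of_le hA.le] at hu
    exact hfun u hu.1
  · refine ContinuousOn.div (by fun_prop) (by fun_prop) ?_
    rintro _ ⟨u, hu, rfl⟩
    rw [min_eq_left hA.le, max_eq_right hA.le] at hu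
    have : 0 < √(u^2) := Real.sqrt_pos.2 (pow_pos hu.1 2)
    exact_mod_cast this.ne'
  · refine IntegrableOn.mono_set ?_ himg
    rw [integrableOn_Icc_iff_integrableOn_Ioc]
    have h0 : IntegrableOn (fun x : ℝ => x ^ (-(1/2) : ℝ)) (Set.Ioc 0 a) := by
      have := (intervalIntegral.intervalIntegrable_rpow' (a := 0) (b := a) (r := -(1/2)) (by norm_num)).1
      exact this
    refine Integrable.mono' h0 (Measurable.aestronglyMeasurable (by fun_prop)) ?_
    filter_upwards [ae_restrict_mem measurableSet_Ioc] with x hx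
    rw [norm_div, Complex.norm_real, Real.norm_of_nonneg (Real.sqrt_nonneg x), Complex.norm_exp,
      Real.rpow_neg hx.1.le, ← Real.sqrt_eq_rpow]
    simp
  · rw [Set.uIcc_of_le hA.le, integrableOn_Icc_iff_integrableOn_Ioc]
    have : IntegrableOn (fun u : ℝ => 2 * Complex.exp (-(Complex.I * t) * (u:ℂ)^2)) (Set.Ioc 0 (√a)) :=
      (Continuous.integrableOn_Icc (by fun_prop)).mono_set Set.Ioc_subset_Icc_self
    refine this.congr_fun (fun u hu => (hfun u hu.1).symm) measurableSet_Ioc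

/-- Lemma A.3: asymptotics of the oscillatory integral `∫₀ᵃ e^{-ixt} x^{-1/2} dx`. -/
theorem osc_int_estim (a : ℝ) (ha : 0 < a) :
    ∃ C > (0 : ℝ), ∃ t₀ > (0 : ℝ), ∀ t ≥ t₀,
      ‖(∫ x in (0 : ℝ)..a, Complex.exp (-Complex.I * x * t) / (Real.sqrt x : ℂ))
          - (Real.sqrt (π / (2 * t)) : ℂ) * (1 - Complex.I)‖ ≤ C / t := by
  have hA := Real.sqrt_pos.2 ha
  refine ⟨2 / √a, by positivity, 1, one_pos, fun t ht => ?_⟩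
  rw [osc_subst a ha t]
  exact osc_gauss _ hA t (by linarith)
end
end

section
/- Let d ≥ 1, μ > 0, and let q_μ(x) := (1+|x|²)^{μ/2} for x ∈ ℝ^d. Let α ∈ C¹(ℝ^d; ℝ) with α(x) ≥ α_min > 0 and ‖α‖_{L^∞} < ∞, and let β ∈ L^∞(ℝ^d; ℝ) with β(x) ≥ β_min > 0. Let u ∈ C_c^∞(ℝ^d; ℂ) and set Pu := −β⁻¹∇·(α∇u). Then (3/4)·α_min·‖q_μ⁻¹∇u‖²_{L²(ℝ^d)} ≤ ‖β‖_{L^∞}·‖q_μ⁻¹Pu‖_{L²(ℝ^d)}·‖q_μ⁻¹u‖_{L²(ℝ^d)} + (μ²/α_min)·‖α‖²_{L^∞}·‖q_μ⁻¹u‖²_{L²(ℝ^d)}. -/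
open MeasureTheory Real

noncomputable section

/-- Partial derivative of a complex-valued function in the `i`-th coordinate direction. -/
def pderivC (d : ℕ) (i : Fin d) (f : EuclideanSpace ℝ (Fin d) → ℂ)
    (x : EuclideanSpace ℝ (Fin d)) : ℂ :=
  fderiv ℝ f x (EuclideanSpace.single i 1)

/-- `∇ · (α ∇ f)`. -/
def divAGrad (d : ℕ) (α : EuclideanSpace ℝ (Fin d) → ℝ)
    (f : EuclideanSpace ℝ (Fin d) → ℂ) (x : EuclideanSpace ℝ (Fin d)) : ℂ :=
  ∑ i, pderivC d i (fun y => (α y : ℂ) * pderivC d i f y) x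

/-- The weight `q_μ(x) = (1 + |x|²)^{μ/2}`. -/
def qweight (d : ℕ) (μ : ℝ) (x : EuclideanSpace ℝ (Fin d)) : ℝ :=
  (1 + ‖x‖ ^ 2) ^ (μ / 2)

lemma wge_q (d : ℕ) (μ : ℝ) (x : EuclideanSpace ℝ (Fin d)) :
    ((qweight d μ x)⁻¹) ^ 2 = (1 + ‖x‖ ^ 2) ^ (-μ) := by
  have h : (0 : ℝ) < 1 + ‖x‖ ^ 2 := by positivity
  unfold qweight
  rw [← Real.rpow_neg h.le, ← Real.rpow_natCast, ← Real.rpow_mul h.le]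
  congr 1
  push_cast
  ring

lemma wge_w_contDiff (d : ℕ) (μ : ℝ) (n : WithTop ℕ∞) :
    ContDiff ℝ n (fun x : EuclideanSpace ℝ (Fin d) => (1 + ‖x‖ ^ 2) ^ (-μ)) := by
  refine ContDiff.rpow_const_of_ne (contDiff_const.add (contDiff_norm_sq ℝ)) ?_
  intro x
  positivity

lemma wge_w_fderiv (d : ℕ) (μ : ℝ) (x : EuclideanSpace ℝ (Fin d)) (i : Fin d) :
    fderiv ℝ (fun x : EuclideanSpace ℝ (Fin d) => (1 + ‖x‖ ^ 2) ^ (-μ)) x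
      (EuclideanSpace.single i 1)
      = -(2 * μ * (x i / (1 + ‖x‖ ^ 2)) * (1 + ‖x‖ ^ 2) ^ (-μ)) := by
  have h : (0 : ℝ) < 1 + ‖x‖ ^ 2 := by positivity
  have h1 := ((hasFDerivAt_id (𝕜 := ℝ) x).norm_sq.const_add 1).rpow_const (p := -μ) (Or.inl h.ne')
  have h2 := h1.fderiv
  simp only [id] at h2
  rw [h2, Real.rpow_sub_one h.ne']
  simp [EuclideanSpace.inner_single_right]
  ring

lemma wge_comp (a b : ℂ) (c A m t P μ : ℝ) (hm : 0 < m) (hc : m ≤ c) (hcA : c ≤ A)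
    (hP : 0 ≤ P) (hμ : 0 < μ) :
    P * (3 / 4 * m * ‖a‖ ^ 2 - μ ^ 2 / m * A ^ 2 * (4 * t ^ 2) * ‖b‖ ^ 2) ≤
      ((c : ℂ) * a * ((P : ℂ) * (starRingEnd ℂ) a
        + ((-(2 * μ * t * P) : ℝ) : ℂ) * (starRingEnd ℂ) b)).re := by
  have e : ((c : ℂ) * a * ((P : ℂ) * (starRingEnd ℂ) a
        + ((-(2 * μ * t * P) : ℝ) : ℂ) * (starRingEnd ℂ) b)).re
      = P * (c * ‖a‖ ^ 2 - 2 * μ * t * c * (a * (starRingEnd ℂ) b).re) := by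
    have : ‖a‖ ^ 2 = a.re * a.re + a.im * a.im := by
      rw [← Complex.normSq_eq_norm_sq, Complex.normSq_apply]
    rw [this]
    simp
    ring
  rw [e]
  apply mul_le_mul_of_nonneg_left _ hP
  have h1 : |(a * (starRingEnd ℂ) b).re| ≤ ‖a‖ * ‖b‖ := by
    refine (Complex.abs_re_le_norm _).trans ?_
    simp
  have hA : 0 < A := by linarith
  have h2 : 2 * μ * t * c * (a * (starRingEnd ℂ) b).re ≤ 2 * μ * |t| * A * (‖a‖ * ‖b‖) := by
    calc _ ≤ |2 * μ * t * c * (a * (starRingEnd ℂ) b).re| := le_abs_self _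
      _ = 2 * μ * |t| * c * |(a * (starRingEnd ℂ) b).re| := by
        rw [abs_mul, abs_mul, abs_mul, abs_mul, abs_of_pos hμ, abs_of_pos (hm.trans_le hc)]
        norm_num
      _ ≤ _ := by gcongr
  have h3 : 2 * μ * |t| * A * (‖a‖ * ‖b‖) ≤
      1 / 4 * m * ‖a‖ ^ 2 + μ ^ 2 / m * A ^ 2 * (4 * t ^ 2) * ‖b‖ ^ 2 := by
    have : 1 / 4 * m * ‖a‖ ^ 2 + μ ^ 2 / m * A ^ 2 * (4 * t ^ 2) * ‖b‖ ^ 2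
        - 2 * μ * |t| * A * (‖a‖ * ‖b‖) = (m * ‖a‖ / 2 - 2 * μ * |t| * A * ‖b‖) ^ 2 / m := by
      rw [← sq_abs t]
      field_simp
      ring
    have : 0 ≤ (m * ‖a‖ / 2 - 2 * μ * |t| * A * ‖b‖) ^ 2 / m := by positivity
    linarith
  have h4 : m * ‖a‖ ^ 2 ≤ c * ‖a‖ ^ 2 := by gcongr
  linarith

lemma wge_opnorm (d : ℕ) (L : EuclideanSpace ℝ (Fin d) →L[ℝ] ℂ) :
    ‖L‖ ^ 2 ≤ ∑ i, ‖L (EuclideanSpace.single i 1)‖ ^ 2 := by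
  have h0 : 0 ≤ ∑ i, ‖L (EuclideanSpace.single i 1)‖ ^ 2 := by positivity
  rw [← Real.le_sqrt (norm_nonneg _) h0]
  refine L.opNorm_le_bound (Real.sqrt_nonneg _) fun v => ?_
  have hv : L v = ∑ i, (v i) • L (EuclideanSpace.single i 1) := by
    conv_lhs => rw [← (EuclideanSpace.basisFun (Fin d) ℝ).sum_repr v]
    simp
  rw [hv, EuclideanSpace.norm_eq, ← Real.sqrt_mul h0]
  apply Real.le_sqrt_of_sq_le
  have h1 : ‖∑ i, (v i) • L (EuclideanSpace.single i 1)‖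
      ≤ ∑ i, ‖L (EuclideanSpace.single i 1)‖ * ‖v i‖ := by
    refine (norm_sum_le _ _).trans (le_of_eq ?_)
    simp [mul_comm]
  exact (pow_le_pow_left₀ (norm_nonneg _) h1 2).trans
    (Finset.sum_mul_sq_le_sq_mul_sq _ _ _)

lemma wge_sum_t (d : ℕ) (x : EuclideanSpace ℝ (Fin d)) :
    ∑ i, 4 * (x i / (1 + ‖x‖ ^ 2)) ^ 2 ≤ 1 := by
  have h : (0 : ℝ) < 1 + ‖x‖ ^ 2 := by positivity
  have : ∑ i, 4 * (x i / (1 + ‖x‖ ^ 2)) ^ 2 = 4 * ‖x‖ ^ 2 / (1 + ‖x‖ ^ 2) ^ 2 := by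
    rw [EuclideanSpace.norm_sq_eq x, mul_div_assoc, Finset.sum_div, Finset.mul_sum]
    simp [div_pow]
  rw [this, div_le_one (by positivity)]
  nlinarith [sq_nonneg (1 - ‖x‖ ^ 2)]

/-- The weighted gradient estimate from the proof of Proposition 2.1. -/
theorem weighted_gradient_estim
    (d : ℕ) (hd : 1 ≤ d) (μ : ℝ) (hμ : 0 < μ)
    (αmin βmin : ℝ) (hαmin : 0 < αmin) (hβmin : 0 < βmin)
    (α β : EuclideanSpace ℝ (Fin d) → ℝ)
    (hα : ContDiff ℝ 1 α) (hαpos : ∀ x, αmin ≤ α x)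
    (hαbd : BddAbove (Set.range fun x => |α x|))
    (hβmeas : Measurable β) (hβpos : ∀ x, βmin ≤ β x)
    (hβbd : BddAbove (Set.range fun x => |β x|))
    (u : EuclideanSpace ℝ (Fin d) → ℂ)
    (husmooth : ContDiff ℝ (⊤ : ℕ∞) u) (husupp : HasCompactSupport u) :
    (3 / 4) * αmin * (∫ x, ((qweight d μ x)⁻¹ * ‖fderiv ℝ u x‖) ^ 2)
      ≤ (⨆ x, |β x|) *
          Real.sqrt (∫ x,
            ((qweight d μ x)⁻¹ * ‖-(β x : ℂ)⁻¹ * divAGrad d α u x‖) ^ 2) *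
          Real.sqrt (∫ x, ((qweight d μ x)⁻¹ * ‖u x‖) ^ 2)
        + (μ ^ 2 / αmin) * (⨆ x, |α x|) ^ 2 *
            (∫ x, ((qweight d μ x)⁻¹ * ‖u x‖) ^ 2) := by
  set A := ⨆ x, |α x| with hA
  set B := ⨆ x, |β x| with hB
  have hαA : ∀ x, α x ≤ A := fun x => (le_abs_self _).trans (le_ciSup hαbd x)
  have hβB : ∀ x, |β x| ≤ B := fun x => le_ciSup hβbd x
  have hB0 : 0 ≤ B := (abs_nonneg _).trans (hβB 0)
  have hβ0 : ∀ x, 0 < β x := fun x => hβmin.trans_le (hβpos x)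
  set w : EuclideanSpace ℝ (Fin d) → ℝ := fun x => (1 + ‖x‖ ^ 2) ^ (-μ) with hw
  have hw0 : ∀ x, 0 ≤ w x := fun x => by simp only [hw]; positivity
  have hwC : ContDiff ℝ 1 w := wge_w_contDiff d μ 1
  have hqw : ∀ x, ((qweight d μ x)⁻¹) ^ 2 = w x := wge_q d μ
  have hqpos : ∀ x, 0 < qweight d μ x := fun x => by unfold qweight; positivity
  have hqc : Continuous (fun x => (qweight d μ x)⁻¹) := by
    have : Continuous (qweight d μ) := by
      unfold qweight
      refine Continuous.rpow_const (by fun_prop) fun x => Or.inl ?_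
      positivity
    exact this.inv₀ fun x => (hqpos x).ne'
  have hu1 : ContDiff ℝ 1 u := husmooth.of_le (by exact_mod_cast le_top)
  have hpC : ∀ i, ContDiff ℝ 1 (pderivC d i u) := fun i => by
    have : ContDiff ℝ 1 (fderiv ℝ u) := 
      husmooth.fderiv_right (WithTop.coe_le_coe.2 le_top)
    exact this.clm_apply contDiff_const
  have hpS : ∀ i, HasCompactSupport (pderivC d i u) := fun i =>
    husupp.fderiv_apply ℝ (EuclideanSpace.single i 1)
  set f : Fin d → EuclideanSpace ℝ (Fin d) → ℂ := fun i y => (α y : ℂ) * pderivC d i u y with hf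
  have hfC : ∀ i, ContDiff ℝ 1 (f i) := fun i =>
    (Complex.ofRealCLM.contDiff.comp hα).mul (hpC i)
  have hfS : ∀ i, HasCompactSupport (f i) := fun i => (hpS i).mul_left
  set g : EuclideanSpace ℝ (Fin d) → ℂ := fun y => (w y : ℂ) * (starRingEnd ℂ) (u y) with hg
  have hwC' : ContDiff ℝ 1 (fun y => (w y : ℂ)) := Complex.ofRealCLM.contDiff.comp hwC
  have hcC : ContDiff ℝ 1 (fun y => (starRingEnd ℂ) (u y)) :=
    Complex.conjCLE.contDiff.comp hu1
  have hgC : ContDiff ℝ 1 g := hwC'.mul hcC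
  have hgS : HasCompactSupport g := by
    have : HasCompactSupport (fun y => (starRingEnd ℂ) (u y)) :=
      husupp.comp_left (g := starRingEnd ℂ) (map_zero _)
    exact this.mul_left
  have hdivc : Continuous (divAGrad d α u) := by
    unfold divAGrad
    refine continuous_finsetSum _ fun i _ => ?_
    exact ((hfC i).continuous_fderiv one_ne_zero).clm_apply continuous_const
  have hdivS : HasCompactSupport (divAGrad d α u) := by
    have : ∀ s : Finset (Fin d), HasCompactSupport (fun x => ∑ i ∈ s, pderivC d i (f i) x) := by
      intro s
      induction s using Finset.cons_induction with
      | empty => 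
        simp only [Finset.sum_empty]
        exact HasCompactSupport.zero
      | cons a s ha ih =>
        simp only [Finset.sum_cons]
        exact ((hfS a).fderiv_apply ℝ (EuclideanSpace.single a 1)).add ih
    exact this Finset.univ
  -- derivative of g
  have hgd : ∀ x i, fderiv ℝ g x (EuclideanSpace.single i 1) =
      (w x : ℂ) * (starRingEnd ℂ) (pderivC d i u x)
        + ((-(2 * μ * (x i / (1 + ‖x‖ ^ 2)) * w x) : ℝ) : ℂ) * (starRingEnd ℂ) (u x) := by
    intro x i
    have h1 : HasFDerivAt (fun y => (w y : ℂ)) (Complex.ofRealCLM.comp (fderiv ℝ w x)) x :=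
      Complex.ofRealCLM.hasFDerivAt.comp x (hwC.differentiable one_ne_zero x).hasFDerivAt
    have h2 : HasFDerivAt (fun y => (starRingEnd ℂ) (u y))
        ((Complex.conjCLE : ℂ →L[ℝ] ℂ).comp (fderiv ℝ u x)) x :=
      (Complex.conjCLE : ℂ →L[ℝ] ℂ).hasFDerivAt.comp x
        (hu1.differentiable one_ne_zero x).hasFDerivAt
    have h3 := (h1.mul h2).fderiv
    have h4 := wge_w_fderiv d μ x i
    rw [← h4]
    change fderiv ℝ ((fun y => (w y : ℂ)) * (fun y => (starRingEnd ℂ) (u y))) x _ = _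
    rw [h3]
    simp [pderivC]
    ring
  have hint1 : ∀ i, Integrable (fun x => f i x * fderiv ℝ g x (EuclideanSpace.single i 1)) :=
    fun i => Continuous.integrable_of_hasCompactSupport
      ((hfC i).continuous.mul ((hgC.continuous_fderiv one_ne_zero).clm_apply continuous_const))
      (hfS i).mul_right
  have hint2 : ∀ i, Integrable (fun x => fderiv ℝ (f i) x (EuclideanSpace.single i 1) * g x) :=
    fun i => Continuous.integrable_of_hasCompactSupport
      ((((hfC i).continuous_fderiv one_ne_zero).clm_apply continuous_const).mul hgC.continuous)
      hgS.mul_left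
  have hibp : ∫ x, ∑ i, f i x * fderiv ℝ g x (EuclideanSpace.single i 1)
      = - ∫ x, divAGrad d α u x * g x := by
    rw [integral_finsetSum _ fun i _ => hint1 i]
    have : (fun x => divAGrad d α u x * g x) =
        fun x => ∑ i, fderiv ℝ (f i) x (EuclideanSpace.single i 1) * g x := by
      funext x
      rw [← Finset.sum_mul]
      rfl
    rw [this, integral_finsetSum _ fun i _ => hint2 i, ← Finset.sum_neg_distrib]
    refine Finset.sum_congr rfl fun i _ => ?_
    exact integral_mul_fderiv_eq_neg_fderiv_mul_of_integrable (hint2 i) (hint1 i)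
      (Continuous.integrable_of_hasCompactSupport ((hfC i).continuous.mul hgC.continuous)
        (hfS i).mul_right)
      (fun x _ => (hfC i).differentiable one_ne_zero x)
      (fun x _ => hgC.differentiable one_ne_zero x)
  have hpt : ∀ x, 3 / 4 * αmin * ((qweight d μ x)⁻¹ * ‖fderiv ℝ u x‖) ^ 2
      - μ ^ 2 / αmin * A ^ 2 * ((qweight d μ x)⁻¹ * ‖u x‖) ^ 2
      ≤ (∑ i, f i x * fderiv ℝ g x (EuclideanSpace.single i 1)).re := by
    intro x
    rw [mul_pow, mul_pow, hqw, Complex.re_sum]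
    have h1 : ∑ i, w x * (3 / 4 * αmin * ‖pderivC d i u x‖ ^ 2
        - μ ^ 2 / αmin * A ^ 2 * (4 * (x i / (1 + ‖x‖ ^ 2)) ^ 2) * ‖u x‖ ^ 2) ≤
        ∑ i, (f i x * fderiv ℝ g x (EuclideanSpace.single i 1)).re := by
      refine Finset.sum_le_sum fun i _ => ?_
      rw [hgd]
      exact wge_comp _ _ _ _ _ _ _ _ hαmin (hαpos x) (hαA x) (hw0 x) hμ
    refine le_trans ?_ h1
    rw [← Finset.mul_sum, Finset.sum_sub_distrib, ← Finset.mul_sum, ← Finset.sum_mul,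
      ← Finset.mul_sum]
    have h2 := wge_opnorm d (fderiv ℝ u x)
    have h3 := wge_sum_t d x
    have h4 : 3 / 4 * αmin * ‖fderiv ℝ u x‖ ^ 2
        ≤ 3 / 4 * αmin * ∑ i, ‖pderivC d i u x‖ ^ 2 := by
      gcongr
      exact h2
    have h5 : μ ^ 2 / αmin * A ^ 2 * (∑ i, 4 * (x i / (1 + ‖x‖ ^ 2)) ^ 2) * ‖u x‖ ^ 2
        ≤ μ ^ 2 / αmin * A ^ 2 * 1 * ‖u x‖ ^ 2 := by
      gcongr
    calc _ = w x * (3 / 4 * αmin * ‖fderiv ℝ u x‖ ^ 2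
          - μ ^ 2 / αmin * A ^ 2 * 1 * ‖u x‖ ^ 2) := by ring
      _ ≤ _ := mul_le_mul_of_nonneg_left (by linarith) (hw0 x)
  -- integrability and L2 facts
  have hfdc : Continuous (fderiv ℝ u) := hu1.continuous_fderiv one_ne_zero
  have hI1 : Integrable (fun x => ((qweight d μ x)⁻¹ * ‖fderiv ℝ u x‖) ^ 2) := by
    refine Continuous.integrable_of_hasCompactSupport ((hqc.mul hfdc.norm).pow 2) ?_
    have h : HasCompactSupport (fun x => (qweight d μ x)⁻¹ * ‖fderiv ℝ u x‖) :=
      HasCompactSupport.mul_left (husupp.fderiv ℝ).norm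
    exact h.comp_left (g := fun t : ℝ => t ^ 2) (by norm_num)
  have hVc : Continuous (fun x => (qweight d μ x)⁻¹ * ‖u x‖) := hqc.mul hu1.continuous.norm
  have hVS : HasCompactSupport (fun x => (qweight d μ x)⁻¹ * ‖u x‖) :=
    HasCompactSupport.mul_left husupp.norm
  have hI2 : Integrable (fun x => ((qweight d μ x)⁻¹ * ‖u x‖) ^ 2) := by
    refine Continuous.integrable_of_hasCompactSupport (hVc.pow 2) ?_
    exact hVS.comp_left (g := fun t : ℝ => t ^ 2) (by norm_num)
  have hVL : MemLp (fun x => (qweight d μ x)⁻¹ * ‖u x‖) (ENNReal.ofReal 2) :=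
    hVc.memLp_of_hasCompactSupport hVS
  have hDc : Continuous (fun x => (qweight d μ x)⁻¹ * ‖divAGrad d α u x‖) := hqc.mul hdivc.norm
  have hDS : HasCompactSupport (fun x => (qweight d μ x)⁻¹ * ‖divAGrad d α u x‖) :=
    HasCompactSupport.mul_left hdivS.norm
  have hPL : MemLp (fun x => (qweight d μ x)⁻¹ * ‖-(β x : ℂ)⁻¹ * divAGrad d α u x‖)
      (ENNReal.ofReal 2) := by
    refine MemLp.of_le_mul (c := βmin⁻¹)
      (hDc.memLp_of_hasCompactSupport hDS : MemLp _ (ENNReal.ofReal 2) volume) ?_ ?_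
    · have hm : Measurable fun x => -(β x : ℂ)⁻¹ :=
        (Complex.measurable_ofReal.comp hβmeas).inv.neg
      exact (hqc.measurable.mul (hm.mul hdivc.measurable).norm).aestronglyMeasurable
    · refine Filter.Eventually.of_forall fun x => ?_
      have h1 : (β x)⁻¹ ≤ βmin⁻¹ := inv_anti₀ hβmin (hβpos x)
      have h2 : (0 : ℝ) ≤ (qweight d μ x)⁻¹ := (inv_pos.2 (hqpos x)).le
      simp only [norm_mul, norm_norm, norm_neg, norm_inv, Complex.norm_real]
      rw [Real.norm_of_nonneg (hβ0 x).le, Real.norm_of_nonneg (hqpos x).le]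
      calc _ = (β x)⁻¹ * ((qweight d μ x)⁻¹ * ‖divAGrad d α u x‖) := by ring
        _ ≤ _ := by gcongr
  have hhol := integral_mul_le_Lp_mul_Lq_of_nonneg Real.HolderConjugate.two_two
    (Filter.Eventually.of_forall fun x => by
      have := (inv_pos.2 (hqpos x)).le
      positivity)
    (Filter.Eventually.of_forall fun x => by
      have := (inv_pos.2 (hqpos x)).le
      positivity) hPL hVL
  simp only [Real.rpow_two, ← Real.sqrt_eq_rpow] at hhol
  have hnorm : ‖∫ x, divAGrad d α u x * g x‖ ≤ B * ∫ x,
      ((qweight d μ x)⁻¹ * ‖-(β x : ℂ)⁻¹ * divAGrad d α u x‖) * ((qweight d μ x)⁻¹ * ‖u x‖) := by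
    rw [← integral_const_mul]
    refine norm_integral_le_of_norm_le ?_ (Filter.Eventually.of_forall fun x => ?_)
    · have : ENNReal.HolderConjugate (ENNReal.ofReal 2) (ENNReal.ofReal 2) := by
        simpa using (inferInstance : ENNReal.HolderConjugate 2 2)
      exact (hPL.integrable_mul hVL).const_mul B
    · have hb := hβ0 x
      have hbB := (le_abs_self _).trans (hβB x)
      have e : ‖divAGrad d α u x * g x‖ = β x * (((qweight d μ x)⁻¹ *
          ‖-(β x : ℂ)⁻¹ * divAGrad d α u x‖) * ((qweight d μ x)⁻¹ * ‖u x‖)) := by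
        simp only [hg, norm_mul, norm_neg, norm_inv, Complex.norm_real, RCLike.norm_conj]
        rw [Real.norm_of_nonneg (hw0 x), Real.norm_of_nonneg hb.le, ← hqw]
        field_simp
      rw [e]
      have := (inv_pos.2 (hqpos x)).le
      gcongr
  have hsumint : Integrable (fun x => ∑ i, f i x * fderiv ℝ g x (EuclideanSpace.single i 1)) :=
    integrable_finsetSum _ fun i _ => hint1 i
  have hmain : ∫ x, (3 / 4 * αmin * ((qweight d μ x)⁻¹ * ‖fderiv ℝ u x‖) ^ 2
      - μ ^ 2 / αmin * A ^ 2 * ((qweight d μ x)⁻¹ * ‖u x‖) ^ 2)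
      ≤ ∫ x, (∑ i, f i x * fderiv ℝ g x (EuclideanSpace.single i 1)).re :=
    integral_mono ((hI1.const_mul _).sub (hI2.const_mul _)) hsumint.re hpt
  have hre : ∫ x, (∑ i, f i x * fderiv ℝ g x (EuclideanSpace.single i 1)).re
      = (∫ x, ∑ i, f i x * fderiv ℝ g x (EuclideanSpace.single i 1)).re :=
    integral_re hsumint
  rw [integral_sub (hI1.const_mul _) (hI2.const_mul _), integral_const_mul, integral_const_mul,
    hre, hibp] at hmain
  have hle : (-∫ x, divAGrad d α u x * g x).re ≤ ‖∫ x, divAGrad d α u x * g x‖ := by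
    rw [← norm_neg]
    exact Complex.re_le_norm _
  have hfin := mul_le_mul_of_nonneg_left hhol hB0
  rw [← mul_assoc] at hfin
  linarith
end
end
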